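/- arXiv:2502.13486 — 2 statements merged into one kernel-verified Lean document; each statement's English description precedes it below -/
import Mathlib

section
/- Let γ_n (n ∈ ℕ) and γ be stochastic kernels from Y to U. Then γ_n converges to γ in the w*-topology if and only if for every Borel set E ⊆ Y the finite measures (μ ⊗ γ_n)(E × ·) converge vaguely to (μ ⊗ γ)(E × ·); that is, if and only if for every Borel set E ⊆ Y and every g ∈ C₀(U), ∫_E ∫_U g(u) γ_n(y)(du) dμ(y) → ∫_E ∫_U g(u) γ(y)(du) dμ(y). -/
open MeasureTheory Filter Topology
open scoped ZeroAtInfty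

section KernelIntegral

open ProbabilityTheory

variable {Y U : Type*} [MeasurableSpace Y] [TopologicalSpace U] {μ : Measure Y}

theorem ZeroAtInftyContinuousMap.norm_apply_le (g : C₀(U, ℝ)) (u : U) : ‖g u‖ ≤ ‖g‖ := by
  rw [← ZeroAtInftyContinuousMap.norm_toBCF_eq_norm]
  exact g.toBCF.norm_coe_le_norm u

instance ZeroAtInftyContinuousMap.instContinuousEval : ContinuousEval C₀(U, ℝ) U ℝ :=
  .of_continuous_forget ZeroAtInftyContinuousMap.isometry_toBCF.continuous

variable [MeasurableSpace U]

theorem integral_integral_indicator_const (κ : Y → Measure U) {E : Set Y}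
    (hE : MeasurableSet E) (g : C₀(U, ℝ)) :
    ∫ y, ∫ u, E.indicator (fun _ => g) y u ∂(κ y) ∂μ = ∫ y in E, ∫ u, g u ∂(κ y) ∂μ := by
  rw [← integral_indicator hE]
  congr 1 with y
  by_cases hy : y ∈ E <;> simp [hy]

theorem ZeroAtInftyContinuousMap.norm_integral_le (g : C₀(U, ℝ)) (ν : Measure U)
    [IsProbabilityMeasure ν] : ‖∫ u, g u ∂ν‖ ≤ ‖g‖ := by
  simpa using norm_integral_le_of_norm_le_const (μ := ν)
    (.of_forall (ZeroAtInftyContinuousMap.norm_apply_le g))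

theorem ZeroAtInftyContinuousMap.integrable [OpensMeasurableSpace U]
    (g : C₀(U, ℝ)) (ν : Measure U) [IsFiniteMeasure ν] : Integrable g ν :=
  Integrable.of_bound (map_continuous g).aestronglyMeasurable ‖g‖
    (.of_forall (ZeroAtInftyContinuousMap.norm_apply_le g))

variable [PolishSpace U] [BorelSpace U]

theorem MeasureTheory.Integrable.integral_kernel_zeroAtInfty (κ : Kernel Y U) [IsMarkovKernel κ]
    {f : Y → C₀(U, ℝ)} (hf : Integrable f μ) :
    Integrable (fun y => ∫ u, f y u ∂(κ y)) μ := by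
  refine hf.norm.mono' ?_ (.of_forall fun y => (f y).norm_integral_le _)
  obtain ⟨g, hg, hfg⟩ := hf.1
  refine ⟨fun y => ∫ u, g y u ∂(κ y), ?_, ?_⟩
  · have h : StronglyMeasurable fun p : Y × U => (g p.1, p.2) :=
      (hg.comp_measurable measurable_fst).prodMk measurable_snd.stronglyMeasurable
    exact (continuous_eval.comp_stronglyMeasurable
      h).integral_kernel_prod_right'
  · filter_upwards [hfg] with y hy
    rw [hy]

theorem dist_integral_integral_kernel_le (κ : Kernel Y U) [IsMarkovKernel κ]
    {f g : Y → C₀(U, ℝ)} (hf : Integrable f μ) (hg : Integrable g μ) :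
    dist (∫ y, ∫ u, f y u ∂(κ y) ∂μ) (∫ y, ∫ u, g y u ∂(κ y) ∂μ) ≤ ∫ y, ‖f y - g y‖ ∂μ := by
  rw [dist_eq_norm, ← integral_sub (hf.integral_kernel_zeroAtInfty κ)
    (hg.integral_kernel_zeroAtInfty κ)]
  refine norm_integral_le_of_norm_le (hf.sub hg).norm (.of_forall fun y => ?_)
  rw [← integral_sub ((f y).integrable _) ((g y).integrable _)]
  exact (f y - g y).norm_integral_le (κ y)

theorem tendsto_integral_integral_kernel {ι : Type*} {l : Filter ι} (κn : ι → Kernel Y U)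
    (κ : Kernel Y U) [∀ n, IsMarkovKernel (κn n)] [IsMarkovKernel κ]
    (h : ∀ E : Set Y, MeasurableSet E → ∀ g : C₀(U, ℝ),
      Tendsto (fun n => ∫ y in E, ∫ u, g u ∂(κn n y) ∂μ) l
        (𝓝 (∫ y in E, ∫ u, g u ∂(κ y) ∂μ)))
    {f : Y → C₀(U, ℝ)} (hf : Integrable f μ) :
    Tendsto (fun n => ∫ y, ∫ u, f y u ∂(κn n y) ∂μ) l (𝓝 (∫ y, ∫ u, f y u ∂(κ y) ∂μ)) := by
  refine Integrable.induction (fun f : Y → C₀(U, ℝ) =>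
    Tendsto (fun n => ∫ y, ∫ u, f y u ∂(κn n y) ∂μ) l (𝓝 (∫ y, ∫ u, f y u ∂(κ y) ∂μ)))
    (fun g E hE _ => ?_) (fun f g _ hf hg ihf ihg => ?_) ?_ (fun f g hfg _ ih => ?_) hf
  · simpa only [integral_integral_indicator_const _ hE] using h _ hE g
  · have key (η : Kernel Y U) [IsMarkovKernel η] :
        ∫ y, ∫ u, (f + g) y u ∂(η y) ∂μ
          = (∫ y, ∫ u, f y u ∂(η y) ∂μ) + ∫ y, ∫ u, g y u ∂(η y) ∂μ := by
      rw [← integral_add (hf.integral_kernel_zeroAtInfty η) (hg.integral_kernel_zeroAtInfty η)]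
      congr 1 with y
      exact integral_add ((f y).integrable _) ((g y).integrable _)
    simpa only [key] using ihf.add ihg
  · refine isClosed_of_closure_subset fun f hf => Metric.tendsto_nhds.2 fun ε hε => ?_
    obtain ⟨g, hg, hfg⟩ := Metric.mem_closure_iff.1 hf (ε / 3) (by positivity)
    have hle (η : Kernel Y U) [IsMarkovKernel η] :
        dist (∫ y, ∫ u, f y u ∂(η y) ∂μ) (∫ y, ∫ u, g y u ∂(η y) ∂μ) < ε / 3 := by
      refine (dist_integral_integral_kernel_le η (L1.integrable_coeFn f)
        (L1.integrable_coeFn g)).trans_lt ?_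
      simpa only [← dist_eq_norm, ← L1.dist_eq_integral_dist] using hfg
    filter_upwards [Metric.tendsto_nhds.1 hg (ε / 3) (by positivity)] with n hn
    have h₁ := hle (κn n)
    have h₂ := hle κ
    rw [dist_comm] at h₂
    linarith [dist_triangle4 (∫ y, ∫ u, f y u ∂(κn n y) ∂μ) (∫ y, ∫ u, g y u ∂(κn n y) ∂μ)
      (∫ y, ∫ u, g y u ∂(κ y) ∂μ) (∫ y, ∫ u, f y u ∂(κ y) ∂μ)]
  · have key (η : Kernel Y U) : ∫ y, ∫ u, g y u ∂(η y) ∂μ = ∫ y, ∫ u, f y u ∂(η y) ∂μ :=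
      integral_congr_ae (hfg.mono fun y hy => by simp only [hy])
    simpa only [key] using ih

end KernelIntegral

/-- Stochastic kernels `γₙ` converge to the stochastic kernel `γ` in the
`w*`-topology (testing against all `f ∈ L¹(μ, C₀(U))`) iff for every Borel set `E ⊆ Y` the
finite measures `(μ ⊗ γₙ)(E × ·)` converge vaguely to `(μ ⊗ γ)(E × ·)`, i.e. for every Borel
`E` and every `g ∈ C₀(U)`, `∫_E ∫_U g dγₙ(y) dμ → ∫_E ∫_U g dγ(y) dμ`. -/
theorem stmt2
    {Y U : Type*} [TopologicalSpace Y] [PolishSpace Y] [MeasurableSpace Y] [BorelSpace Y]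
    [TopologicalSpace U] [PolishSpace U] [LocallyCompactSpace U]
    [MeasurableSpace U] [BorelSpace U]
    (μ : Measure Y) [IsProbabilityMeasure μ]
    (γn : ℕ → Y → Measure U) (γ : Y → Measure U)
    (hγn_meas : ∀ n, ∀ D : Set U, MeasurableSet D → Measurable fun y => γn n y D)
    (hγn_prob : ∀ n y, IsProbabilityMeasure (γn n y))
    (hγ_meas : ∀ D : Set U, MeasurableSet D → Measurable fun y => γ y D)
    (hγ_prob : ∀ y, IsProbabilityMeasure (γ y)) :
    (∀ f : Y → C₀(U, ℝ), Integrable f μ →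
      Tendsto (fun n => ∫ y, ∫ u, f y u ∂(γn n y) ∂μ) atTop
        (𝓝 (∫ y, ∫ u, f y u ∂(γ y) ∂μ)))
    ↔ (∀ E : Set Y, MeasurableSet E → ∀ g : C₀(U, ℝ),
      Tendsto (fun n => ∫ y in E, ∫ u, g u ∂(γn n y) ∂μ) atTop
        (𝓝 (∫ y in E, ∫ u, g u ∂(γ y) ∂μ))) := by
  refine ⟨fun h E hE g => ?_, fun h f hf => ?_⟩
  · simpa only [integral_integral_indicator_const _ hE] using
      h (E.indicator fun _ => g) ((integrable_const g).indicator hE)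
  · let κn (n : ℕ) : ProbabilityTheory.Kernel Y U :=
      ⟨γn n, Measure.measurable_of_measurable_coe _ (hγn_meas n)⟩
    let κ : ProbabilityTheory.Kernel Y U := ⟨γ, Measure.measurable_of_measurable_coe _ hγ_meas⟩
    have (n : ℕ) : ProbabilityTheory.IsMarkovKernel (κn n) := ⟨hγn_prob n⟩
    have : ProbabilityTheory.IsMarkovKernel κ := ⟨hγ_prob⟩
    exact tendsto_integral_integral_kernel κn κ h hf
end

section
/- Let G ⊆ P(U) be tight: for every ε > 0 there exists a compact set K ⊆ U with sup_{ν ∈ G} ν(U ∖ K) < ε. Let γ_n (n ∈ ℕ) be stochastic kernels from Y to U with γ_n(y) ∈ G for μ-almost every y, and let γ : Y → M(U) be a weakly* measurable map such that γ(y) is a nonnegative sub-probability measure for every y. If γ_n converges to γ in the weak kernel mean embedding topology, i.e., ∫_Y ⟪I(γ_n(y)), g(y)⟫ dμ(y) → ∫_Y ⟪I(γ(y)), g(y)⟫ dμ(y) for every g ∈ L¹(μ, H), then γ(y) is a probability measure for μ-almost every y; that is, the closure of the set of stochastic kernels taking values in G with respect to the weak kernel mean embedding topology is contained in the set of stochastic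 kernels. -/
open MeasureTheory Filter Topology
open scoped ZeroAtInfty RealInnerProductSpace

open Set

/-- A dense family in `C₀(U, ℝ)` contains uniform approximations of a Urysohn function that is `1`
on a given compact set. -/
theorem exists_zeroAtInfty_approx_indicator {U H : Type*} [TopologicalSpace U] [R1Space U]
    [LocallyCompactSpace U] {T : H → C₀(U, ℝ)} (hT : DenseRange T) {K : Set U}
    (hK : IsCompact K) {δ : ℝ} (hδ : 0 < δ) :
    ∃ h : H, ∀ u, K.indicator 1 u - δ ≤ T h u ∧ T h u ≤ 1 + δ := by
  obtain ⟨f, hf1, -, hfc, hf⟩ :=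
    exists_continuous_one_zero_of_isCompact hK isClosed_empty (disjoint_empty K)
  let φ : C₀(U, ℝ) := ⟨f, hfc.is_zero_at_infty⟩
  obtain ⟨h, hh⟩ := hT.exists_dist_lt φ hδ
  refine ⟨h, fun u => ?_⟩
  have hu : |f u - T h u| < δ :=
    (BoundedContinuousFunction.dist_coe_le_dist (f := φ.toBCF) (g := (T h).toBCF) u).trans_lt hh
  have hi : K.indicator (1 : U → ℝ) u ≤ f u := by
    by_cases hK : u ∈ K
    · simp [hK, hf1 hK]
    · simp [hK, (hf u).1]
  have := abs_lt.1 hu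
  exact ⟨by linarith, by linarith [(hf u).2]⟩

theorem integrable_zeroAtInfty {U : Type*} [TopologicalSpace U] [MeasurableSpace U]
    [OpensMeasurableSpace U] [SecondCountableTopology U] (f : C₀(U, ℝ)) (ν : Measure U)
    [IsFiniteMeasure ν] : Integrable f ν :=
  .of_bound f.continuous.aestronglyMeasurable ‖f.toBCF‖ <|
    .of_forall fun u => f.toBCF.norm_coe_le_norm u

theorem norm_integral_zeroAtInfty_le {U : Type*} [TopologicalSpace U] [MeasurableSpace U]
    (f : C₀(U, ℝ)) {ν : Measure U} (hν : ν univ ≤ 1) : ‖∫ u, f u ∂ν‖ ≤ ‖f.toBCF‖ := by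
  have : IsFiniteMeasure ν := ⟨hν.trans_lt ENNReal.one_lt_top⟩
  refine (norm_integral_le_of_norm_le_const
    (.of_forall fun u => f.toBCF.norm_coe_le_norm u)).trans ?_
  exact mul_le_of_le_one_right (norm_nonneg _)
    (ENNReal.toReal_le_of_le_ofReal zero_le_one (by simpa))

theorem sub_le_integral_of_indicator_sub_le {U : Type*} [MeasurableSpace U] {ν : Measure U}
    [IsProbabilityMeasure ν] {K : Set U} (hK : MeasurableSet K) {f : U → ℝ}
    (hf : Integrable f ν) {δ : ℝ} (hle : ∀ u, K.indicator 1 u - δ ≤ f u) :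
    1 - ν.real Kᶜ - δ ≤ ∫ u, f u ∂ν := by
  have hi : Integrable (K.indicator (1 : U → ℝ)) ν := (integrable_const 1).indicator hK
  calc 1 - ν.real Kᶜ - δ = ∫ u, (K.indicator 1 u - δ) ∂ν := by
        rw [integral_sub hi (integrable_const _), integral_indicator_one hK,
          probReal_compl_eq_one_sub hK]
        simp
    _ ≤ ∫ u, f u ∂ν := integral_mono (hi.sub (integrable_const _)) hf hle

/-- If bounded measurable functions `fₙ ≥ c` have set integrals converging to those of `f`, then
`f ≥ c` almost everywhere. -/
theorem ae_le_of_tendsto_setIntegral {Y : Type*} [MeasurableSpace Y] {μ : Measure Y}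
    [IsFiniteMeasure μ] {f : Y → ℝ} {F : ℕ → Y → ℝ} {c : ℝ} (hf : Integrable f μ)
    (hF : ∀ n, Integrable (F n) μ) (hc : ∀ n, ∀ᵐ y ∂μ, c ≤ F n y)
    (hlim : ∀ A, MeasurableSet A →
      Tendsto (fun n => ∫ y in A, F n y ∂μ) atTop (𝓝 (∫ y in A, f y ∂μ))) :
    ∀ᵐ y ∂μ, c ≤ f y := by
  refine ae_le_of_forall_setIntegral_le (integrable_const c) hf fun A hA _ => ?_
  exact ge_of_tendsto' (hlim A hA) fun n =>
    setIntegral_mono_ae (integrable_const c).integrableOn (hF n).integrableOn (hc n)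

/-- Let `G ⊆ P(U)` be tight.  If stochastic kernels `γₙ` taking values in `G`
(`μ`-a.e.) converge in the weak kernel mean embedding topology (testing the embeddings
`I(γₙ(y)) = ∫ Φ dγₙ(y)` against all `g ∈ L¹(μ, H)`) to a weakly* measurable sub-probability
valued map `γ`, then `γ(y)` is a probability measure for `μ`-a.e. `y`: the closure of the
set of `G`-valued stochastic kernels in the weak kernel mean embedding topology is contained
in the set of stochastic kernels. -/
theorem stmt18
    {Y U : Type*} [TopologicalSpace Y] [PolishSpace Y] [MeasurableSpace Y] [BorelSpace Y]
    [TopologicalSpace U] [PolishSpace U] [LocallyCompactSpace U]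
    [MeasurableSpace U] [BorelSpace U]
    (μ : Measure Y) [IsProbabilityMeasure μ]
    {H : Type*} [NormedAddCommGroup H] [InnerProductSpace ℝ H] [CompleteSpace H]
    [TopologicalSpace.SeparableSpace H]
    (Φ : U → H) (hΦ_cont : Continuous Φ) (M : ℝ) (hM : ∀ u, ‖Φ u‖ ≤ M)
    (T : H → C₀(U, ℝ)) (hT : ∀ (h : H) (u : U), T h u = ⟪h, Φ u⟫)
    (hT_dense : DenseRange T)
    (G : Set (Measure U)) (hG_prob : ∀ ν ∈ G, IsProbabilityMeasure ν)
    (hG_tight : ∀ ε : ℝ, 0 < ε → ∃ K : Set U, IsCompact K ∧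
      (⨆ ν ∈ G, ν (Set.univ \ K)) < ENNReal.ofReal ε)
    (γn : ℕ → Y → Measure U)
    (hγn_meas : ∀ n, ∀ D : Set U, MeasurableSet D → Measurable fun y => γn n y D)
    (hγn_prob : ∀ n y, IsProbabilityMeasure (γn n y))
    (hγn_G : ∀ n, ∀ᵐ y ∂μ, γn n y ∈ G)
    (γ : Y → Measure U)
    (hγ_wm : ∀ g : C₀(U, ℝ), Measurable fun y => ∫ u, g u ∂(γ y))
    (hγ_sub : ∀ y, γ y Set.univ ≤ 1)
    (hconv : ∀ g : Y → H, Integrable g μ →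
      Tendsto (fun n => ∫ y, ⟪∫ u, Φ u ∂(γn n y), g y⟫ ∂μ) atTop
        (𝓝 (∫ y, ⟪∫ u, Φ u ∂(γ y), g y⟫ ∂μ))) :
    ∀ᵐ y ∂μ, IsProbabilityMeasure (γ y) := by
  have hfin (y : Y) : IsFiniteMeasure (γ y) := ⟨(hγ_sub y).trans_lt ENNReal.one_lt_top⟩
  have key (δ : ℝ) (hδ : 0 < δ) : ∀ᵐ y ∂μ, 1 - 3 * δ ≤ (γ y).real univ := by
    obtain ⟨K, hK, hGK⟩ := hG_tight δ hδ
    obtain ⟨h, hh⟩ := exists_zeroAtInfty_approx_indicator hT_dense hK hδ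
    have hinner (ν : Measure U) [IsFiniteMeasure ν] :
        ⟪∫ u, Φ u ∂ν, h⟫ = ∫ u, T h u ∂ν := by
      rw [real_inner_comm, ← integral_inner
        (.of_bound hΦ_cont.aestronglyMeasurable M (.of_forall hM))]
      simp only [hT]
    have hF (n : ℕ) : Integrable (fun y => ∫ u, T h u ∂(γn n y)) μ := by
      let κ : ProbabilityTheory.Kernel Y U :=
        ⟨γn n, Measure.measurable_of_measurable_coe _ (hγn_meas n)⟩
      have : ProbabilityTheory.IsMarkovKernel κ := ⟨hγn_prob n⟩
      exact .of_bound ((T h).continuous.stronglyMeasurable.integral_kernel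
        (κ := κ)).aestronglyMeasurable _
        (.of_forall fun y => norm_integral_zeroAtInfty_le (T h) prob_le_one)
    have hlow : ∀ᵐ y ∂μ, 1 - δ - δ ≤ ∫ u, T h u ∂(γ y) := by
      refine ae_le_of_tendsto_setIntegral
        (.of_bound (hγ_wm (T h)).aestronglyMeasurable _
          (.of_forall fun y => norm_integral_zeroAtInfty_le (T h) (hγ_sub y)))
        hF (fun n => ?_) (fun A hA => ?_)
      · filter_upwards [hγn_G n] with y hy
        have hν : (γn n y).real Kᶜ ≤ δ := by
          refine ENNReal.toReal_le_of_le_ofReal hδ.le ?_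
          rw [compl_eq_univ_sdiff]
          exact (le_biSup (fun ν : Measure U => ν (univ \ K)) hy).trans hGK.le
        have := sub_le_integral_of_indicator_sub_le (ν := γn n y) hK.measurableSet
          (integrable_zeroAtInfty (T h) _) fun u => (hh u).1
        linarith
      · have hset (κ : Y → Measure U) [∀ y, IsFiniteMeasure (κ y)] :
            ∫ y, ⟪∫ u, Φ u ∂(κ y), A.indicator (fun _ => h) y⟫ ∂μ =
              ∫ y in A, ∫ u, T h u ∂(κ y) ∂μ := by
          rw [← integral_indicator hA]
          congr with y
          by_cases hy : y ∈ A <;> simp [hy, hinner]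
        simpa only [hset] using hconv (A.indicator fun _ => h) ((integrable_const h).indicator hA)
    filter_upwards [hlow] with y hy
    have hup : ∫ u, T h u ∂(γ y) ≤ (γ y).real univ * (1 + δ) := by
      simpa using integral_mono (integrable_zeroAtInfty (T h) (γ y)) (integrable_const (1 + δ))
        fun u => (hh u).2
    have hle : (γ y).real univ ≤ 1 :=
      ENNReal.toReal_le_of_le_ofReal zero_le_one (by simpa using hγ_sub y)
    nlinarith
  have hall : ∀ᵐ y ∂μ, ∀ n : ℕ, 1 - 3 * (1 / ((n : ℝ) + 1)) ≤ (γ y).real univ :=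
    ae_all_iff.2 fun n => key _ Nat.one_div_pos_of_nat
  filter_upwards [hall] with y hy
  have hge : 1 ≤ (γ y).real univ := by
    have hlim : Tendsto (fun n : ℕ => 1 - 3 * (1 / ((n : ℝ) + 1))) atTop (𝓝 1) := by
      simpa using (tendsto_one_div_add_atTop_nhds_zero_nat.const_mul (3 : ℝ)).const_sub 1
    exact le_of_tendsto' hlim hy
  refine ⟨(hγ_sub y).antisymm ?_⟩
  simpa using (ENNReal.ofReal_le_iff_le_toReal (measure_ne_top _ _)).2 hge
end
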